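/- Let V : [0,1] × S → ℝ be such that for every x' ∈ S the map p ↦ V(p,x') is concave on [0,1]. Then for every x ∈ S, the continuation map p ↦ Σ_{x'∈S} P(x'|p,x)·V(Φ(x',x,p), x') is concave on [0,1]. -/

import Mathlib

open Finset Filter Topology

noncomputable section

/-- `p̄ = p + ρ(1-p)`, the predicted change probability. -/
def pbar (ρ p : ℝ) : ℝ := p + ρ * (1 - p)

/-- Likelihood ratio `L(x',x) = Q₂(x'|x) / Q₁(x'|x)`. -/
def likeRatio {S : Type*} (Q1 Q2 : S → S → ℝ) (x' x : S) : ℝ := Q2 x x' / Q1 x x'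

/-- Bayesian posterior update `Φ(x',x,p)`. -/
def post {S : Type*} (Q1 Q2 : S → S → ℝ) (ρ : ℝ) (x' x : S) (p : ℝ) : ℝ :=
  pbar ρ p * likeRatio Q1 Q2 x' x / (pbar ρ p * likeRatio Q1 Q2 x' x + (1 - pbar ρ p))

/-- Predictive probability `P(x'|p,x)`. -/
def pred {S : Type*} (Q1 Q2 : S → S → ℝ) (ρ : ℝ) (x' : S) (p : ℝ) (x : S) : ℝ :=
  (1 - pbar ρ p) * Q1 x x' + pbar ρ p * Q2 x x'

/-- The Bellman operator `B`. -/
def bell {S : Type*} [Fintype S] (Q1 Q2 : S → S → ℝ) (ρ lam : ℝ)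
    (V : ℝ → S → ℝ) : ℝ → S → ℝ :=
  fun p x => min (lam * (1 - p))
    (p + ∑ x' : S, pred Q1 Q2 ρ x' p x * V (post Q1 Q2 ρ x' x p) x')

/-- The stopping cost `ψ(p,x) = λ(1-p)`. -/
def psi (S : Type*) (lam : ℝ) : ℝ → S → ℝ := fun p _ => lam * (1 - p)

/-- The perspective of a concave function along affine maps is concave: if `u > 0` and `w / u`
takes values in the domain of `f`, then `u * f (w / u)` is concave. -/
theorem ConcaveOn.perspective {E : Type*} [AddCommGroup E] [Module ℝ E] {s : Set ℝ} {t : Set E}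
    {f : ℝ → ℝ} (hf : ConcaveOn ℝ s f) (ht : Convex ℝ t) (u w : E →ᵃ[ℝ] ℝ)
    (hu : ∀ x ∈ t, 0 < u x) (hw : ∀ x ∈ t, w x / u x ∈ s) :
    ConcaveOn ℝ t fun x => u x * f (w x / u x) := by
  refine ⟨ht, fun x hx y hy a b ha hb hab => ?_⟩
  have hux := hu x hx
  have huy := hu y hy
  have huz := hu _ (ht hx hy ha hb hab)
  have hwz : w (a • x + b • y) = a * w x + b * w y := by
    simpa using Convex.combo_affine_apply (f := w) (x := x) (y := y) hab
  have huz_eq : u (a • x + b • y) = a * u x + b * u y := by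
    simpa using Convex.combo_affine_apply (f := u) (x := x) (y := y) hab
  set z := a • x + b • y
  have hsum : a * u x / u z + b * u y / u z = 1 := by
    rw [← add_div, ← huz_eq, div_self huz.ne']
  have hα : 0 ≤ a * u x / u z := by positivity
  have hβ : 0 ≤ b * u y / u z := by positivity
  have key := hf.2 (hw x hx) (hw y hy) hα hβ hsum
  have harg : (a * u x / u z) • (w x / u x) + (b * u y / u z) • (w y / u y) = w z / u z := by
    rw [hwz, smul_eq_mul, smul_eq_mul]
    field_simp
  rw [harg] at key
  calc a • (u x * f (w x / u x)) + b • (u y * f (w y / u y))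
      = u z * ((a * u x / u z) • f (w x / u x) + (b * u y / u z) • f (w y / u y)) := by
        simp only [smul_eq_mul]
        field_simp
    _ ≤ u z * f (w z / u z) := mul_le_mul_of_nonneg_left key huz.le

/-- A finite sum of concave functions on a convex set is concave. -/
theorem ConcaveOn.finset_sum {E ι : Type*} [AddCommGroup E] [Module ℝ E] {t : Set E}
    (ht : Convex ℝ t) (I : Finset ι) {f : ι → E → ℝ} (hf : ∀ i ∈ I, ConcaveOn ℝ t (f i)) :
    ConcaveOn ℝ t fun x => ∑ i ∈ I, f i x := by
  rw [← Finset.sum_fn]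
  exact Finset.sum_induction f (ConcaveOn ℝ t) (fun _ _ => ConcaveOn.add)
    (concaveOn_const 0 ht) hf

/-- The posterior is the post-change share of the predictive probability. -/
theorem post_eq_div_pred {S : Type*} {Q1 Q2 : S → S → ℝ} {ρ : ℝ} {x' x : S} (p : ℝ)
    (h : Q1 x x' ≠ 0) :
    post Q1 Q2 ρ x' x p = pbar ρ p * Q2 x x' / pred Q1 Q2 ρ x' p x := by
  rw [post, pred, likeRatio, ← mul_div_mul_right _ _ h]
  congr 1 <;> field_simp
  ring

/-- For nonnegative `ρ ≤ 1`, the predicted change probability lies in `[0,1]`. -/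
theorem pbar_mem_Icc {ρ p : ℝ} (hρ : ρ ∈ Set.Icc (0 : ℝ) 1) (hp : p ∈ Set.Icc (0 : ℝ) 1) :
    pbar ρ p ∈ Set.Icc (0 : ℝ) 1 := by
  obtain ⟨hρ0, hρ1⟩ := hρ
  obtain ⟨hp0, hp1⟩ := hp
  constructor <;> unfold pbar <;> nlinarith

/-- The predictive probability of a state is positive when both kernels are. -/
theorem pred_pos {S : Type*} {Q1 Q2 : S → S → ℝ} {ρ p : ℝ} {x' x : S}
    (h1 : 0 < Q1 x x') (h2 : 0 < Q2 x x') (h : pbar ρ p ∈ Set.Icc (0 : ℝ) 1) :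
    0 < pred Q1 Q2 ρ x' p x :=
  convex_Ioi (0 : ℝ) h1 h2 (sub_nonneg.2 h.2) h.1 (sub_add_cancel _ _)

/-- Each summand of the continuation map is concave in the belief. -/
theorem concaveOn_pred_mul_post {S : Type*} {Q1 Q2 : S → S → ℝ} {ρ : ℝ} {x' x : S}
    (h1 : 0 < Q1 x x') (h2 : 0 < Q2 x x') (hρ : ρ ∈ Set.Icc (0 : ℝ) 1)
    {f : ℝ → ℝ} (hf : ConcaveOn ℝ (Set.Icc (0 : ℝ) 1) f) :
    ConcaveOn ℝ (Set.Icc (0 : ℝ) 1)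
      fun p => pred Q1 Q2 ρ x' p x * f (post Q1 Q2 ρ x' x p) := by
  let u : ℝ →ᵃ[ℝ] ℝ := AffineMap.lineMap ((1 - ρ) * Q1 x x' + ρ * Q2 x x') (Q2 x x')
  let w : ℝ →ᵃ[ℝ] ℝ := AffineMap.lineMap (ρ * Q2 x x') (Q2 x x')
  have hu (p : ℝ) : u p = pred Q1 Q2 ρ x' p x := by
    simp only [u, AffineMap.lineMap_apply_ring', pred, pbar]
    ring
  have hw (p : ℝ) : w p = pbar ρ p * Q2 x x' := by
    simp only [w, AffineMap.lineMap_apply_ring', pbar]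
    ring
  have hpos : ∀ p ∈ Set.Icc (0 : ℝ) 1, 0 < u p := fun p hp => by
    rw [hu]
    exact pred_pos h1 h2 (pbar_mem_Icc hρ hp)
  refine (hf.perspective (convex_Icc 0 1) u w hpos fun p hp => ?_).congr fun p _ => ?_
  · have hb := pbar_mem_Icc hρ hp
    have hw0 : 0 ≤ w p := hw p ▸ mul_nonneg hb.1 h2.le
    have hwu : w p ≤ u p := by
      rw [hw, hu, pred]
      exact le_add_of_nonneg_left (mul_nonneg (sub_nonneg.2 hb.2) h1.le)
    exact ⟨div_nonneg hw0 (hpos p hp).le, (div_le_one (hpos p hp)).2 hwu⟩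
  · simp only [hu, hw, post_eq_div_pred p h1.ne']

theorem stmt_4 {S : Type*} [Fintype S] [Nonempty S]
    (Q1 Q2 : S → S → ℝ)
    (hQ1pos : ∀ x x', 0 < Q1 x x') (hQ2pos : ∀ x x', 0 < Q2 x x')
    (hQ1row : ∀ x, ∑ x', Q1 x x' = 1) (hQ2row : ∀ x, ∑ x', Q2 x x' = 1)
    (ρ : ℝ) (hρ : ρ ∈ Set.Ioo (0 : ℝ) 1)
    (lam : ℝ) (hlam : 0 < lam)
    (V : ℝ → S → ℝ)
    (hV : ∀ x' : S, ConcaveOn ℝ (Set.Icc (0 : ℝ) 1) (fun p => V p x')) :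
    ∀ x : S, ConcaveOn ℝ (Set.Icc (0 : ℝ) 1)
      (fun p => ∑ x' : S, pred Q1 Q2 ρ x' p x * V (post Q1 Q2 ρ x' x p) x') := by
  exact fun x => ConcaveOn.finset_sum (convex_Icc 0 1) _ fun x' _ =>
    concaveOn_pred_mul_post (hQ1pos x x') (hQ2pos x x') (Set.Ioo_subset_Icc_self hρ) (hV x')
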